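/- Theorem: Let c : X₁ × ⋯ × X_d → [0,∞) be continuous and bounded by a sum of integrable functions, i.e., c(x₁,…,x_d) ≤ f₁(x₁) + ⋯ + f_d(x_d) for some fᵢ ∈ L¹(μᵢ). If μ ∈ ℳ(μ₁,…,μ_d) is concentrated on a c-cyclically monotone set, then μ minimizes ∫ c dμ' over all μ' ∈ ℳ(μ₁,…,μ_d). -/

import Mathlib

open scoped BigOperators
open MeasureTheory

noncomputable section

/-- Multi-marginal `c`-cyclical monotonicity. -/
def CyclMono {d : ℕ} {X : Fin d → Type*} (c : (∀ i, X i) → ℝ)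
    (Γ : Set (∀ i, X i)) : Prop :=
  ∀ (n : ℕ) (x : Fin n → ∀ i, X i), (∀ k, x k ∈ Γ) →
    ∀ σ : Fin d → Equiv.Perm (Fin n), (∀ h : 0 < d, σ ⟨0, h⟩ = 1) →
      ∑ k, c (x k) ≤ ∑ k, c (fun i => x (σ i k) i)

open Filter Topology ProbabilityTheory

/-- The normalization `σ₁ = id` in cyclical monotonicity is immaterial. -/
lemma CyclMono.sum_le {d : ℕ} {X : Fin d → Type*} {c : (∀ i, X i) → ℝ} {Γ : Set (∀ i, X i)}
    (h : CyclMono c Γ) {n : ℕ} {x : Fin n → ∀ i, X i} (hx : ∀ k, x k ∈ Γ)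
    (σ : Fin d → Equiv.Perm (Fin n)) :
    ∑ k, c (x k) ≤ ∑ k, c (fun i => x (σ i k) i) := by
  rcases Nat.eq_zero_or_pos d with rfl | hd
  · exact h n x hx σ fun h0 => absurd h0 (lt_irrefl 0)
  · refine (h n x hx (fun i => σ i * (σ ⟨0, hd⟩)⁻¹) fun _ => mul_inv_cancel _).trans_eq ?_
    rw [← Equiv.sum_comp (σ ⟨0, hd⟩)]
    simp

/-- Two labelings of a finite set can be matched by a permutation, up to at most the total
discrepancy between their label counts. -/
lemma exists_perm_card_ne_le {α L : Type*} [Fintype α] [DecidableEq α] [Fintype L]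
    [DecidableEq L] (p q : α → L) :
    ∃ σ : Equiv.Perm α, (∑ k, if p (σ k) = q k then (0 : ℝ) else 1) ≤
      ∑ l, |(∑ k, if p k = l then (1 : ℝ) else 0) - ∑ k, if q k = l then (1 : ℝ) else 0| := by
  obtain ⟨σ, hσ⟩ := Finite.exists_min
    fun σ : Equiv.Perm α => ∑ k, if p (σ k) = q k then (0 : ℝ) else 1
  refine ⟨σ, ?_⟩
  have hfiber : (∑ k, if p (σ k) = q k then (0 : ℝ) else 1) =
      ∑ l, ∑ k, if q k = l ∧ p (σ k) ≠ l then (1 : ℝ) else 0 := by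
    rw [Finset.sum_comm]
    refine Finset.sum_congr rfl fun k _ => ?_
    rw [Finset.sum_eq_single (q k)]
    · by_cases hk : p (σ k) = q k <;> simp [hk]
    · intro l _ hl
      simp [hl.symm]
    · simp
  rw [hfiber]
  refine Finset.sum_le_sum fun l _ => ?_
  by_cases hl : ∃ k, q k = l ∧ p (σ k) ≠ l
  · obtain ⟨k₀, hk₀, hpk₀⟩ := hl
    have hmatch : ∀ k, p (σ k) = l → q k = l := by
      intro k hk
      by_contra hqk
      have hne : k₀ ≠ k := by
        rintro rfl
        exact hqk hk₀
      refine (hσ (σ * Equiv.swap k₀ k)).not_gt (Finset.sum_lt_sum ?_ ⟨k₀, Finset.mem_univ _, ?_⟩)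
      · intro j _
        rcases eq_or_ne j k₀ with rfl | hj
        · simp only [Equiv.Perm.mul_apply, Equiv.swap_apply_left, hk, hk₀, if_true]
          split_ifs <;> simp
        rcases eq_or_ne j k with rfl | hj'
        · rw [if_neg (c := p (σ j) = q j) (by rw [hk]; exact Ne.symm hqk)]
          split_ifs <;> simp
        · simp [Equiv.swap_apply_of_ne_of_ne hj hj']
      · simp [hk, hk₀, hpk₀]
    rw [abs_sub_comm]
    refine le_trans (le_of_eq ?_) (le_abs_self _)
    rw [← Equiv.sum_comp σ fun k => if p k = l then (1 : ℝ) else 0, ← Finset.sum_sub_distrib]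
    refine Finset.sum_congr rfl fun k _ => ?_
    by_cases h₁ : p (σ k) = l
    · simp [h₁, hmatch k h₁]
    · simp [h₁]
  · push Not at hl
    refine le_trans (le_of_eq (Finset.sum_eq_zero fun k _ => ?_)) (abs_nonneg _)
    exact if_neg fun h => h.2 (hl k h.1)

/-- The strong law of large numbers for empirical averages of a single function along an
i.i.d. sample. -/
lemma ae_tendsto_average {Ω : Type*} [MeasurableSpace Ω] (P : Measure Ω)
    [IsProbabilityMeasure P] {g : Ω → ℝ} (hg : Integrable g P) :
    ∀ᵐ x ∂(Measure.infinitePi fun _ : ℕ => P),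
      Tendsto (fun n : ℕ => (∑ k : Fin n, g (x k)) / n) atTop (𝓝 (∫ ω, g ω ∂P)) := by
  have heval := fun k : ℕ => measurePreserving_eval_infinitePi (fun _ : ℕ => P) k
  have hgm : ∀ k : ℕ, AEMeasurable g
      ((Measure.infinitePi fun _ : ℕ => P).map (Function.eval k)) := fun k => by
    rw [(heval k).map_eq]
    exact hg.aemeasurable
  have hindep : iIndepFun (fun (k : ℕ) (x : ℕ → Ω) => x k) (Measure.infinitePi fun _ => P) :=
    iIndepFun_infinitePi (X := fun _ ω => ω) fun _ => measurable_id
  have hslln := strong_law_ae_real (μ := Measure.infinitePi fun _ : ℕ => P)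
    (fun k x => g (x k)) ((heval 0).integrable_comp_of_integrable hg)
    (fun i j hij => (hindep.indepFun hij).comp₀ (heval i).aemeasurable (heval j).aemeasurable
      (hgm i) (hgm j))
    (fun k => IdentDistrib.comp_of_aemeasurable
      ⟨(heval k).aemeasurable, (heval 0).aemeasurable,
        (heval k).map_eq.trans (heval 0).map_eq.symm⟩ (hgm k))
  have hint : ∫ x : ℕ → Ω, g (x 0) ∂(Measure.infinitePi fun _ => P) = ∫ ω, g ω ∂P := by
    have h := integral_map (heval 0).aemeasurable
      (by rw [(heval 0).map_eq]; exact hg.aestronglyMeasurable :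
        AEStronglyMeasurable g ((Measure.infinitePi fun _ : ℕ => P).map (Function.eval 0)))
    rw [(heval 0).map_eq] at h
    exact h.symm
  rw [hint] at hslln
  filter_upwards [hslln] with x hx
  simpa only [Finset.sum_range] using hx

/-- A continuous function on a finite product is, up to `ε` and outside a set of small measure,
controlled by finitely many measurable labels of the coordinates. -/
lemma exists_labels {ι : Type*} [Finite ι] {X : ι → Type*}
    [∀ i, TopologicalSpace (X i)] [∀ i, SecondCountableTopology (X i)]
    [∀ i, MeasurableSpace (X i)] [∀ i, BorelSpace (X i)]
    {c : (∀ i, X i) → ℝ} (hc : Continuous c) (ν : Measure (∀ i, X i)) [IsProbabilityMeasure ν]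
    {ε δ : ℝ} (hε : 0 < ε) (hδ : 0 < δ) :
    ∃ (m : ℕ) (q : ∀ i, X i → Fin m → Prop) (G : Set (∀ i, X i)),
      (∀ i, Measurable (q i)) ∧ MeasurableSet G ∧ ν.real Gᶜ < δ ∧
      ∀ y ∈ G, ∀ x, (∀ i, q i (x i) = q i (y i)) → c x ≤ c y + ε := by
  have hbox : ∀ z : ∀ i, X i, ∃ u : ∀ i, Set (X i), (∀ i, IsOpen (u i) ∧ z i ∈ u i) ∧
      Set.univ.pi u ⊆ c ⁻¹' Metric.ball (c z) (ε / 2) := fun z =>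
    isOpen_pi_iff'.1 (Metric.isOpen_ball.preimage hc) z (Metric.mem_ball_self (half_pos hε))
  choose u hu hsub using hbox
  have hopen : ∀ z, IsOpen (Set.univ.pi (u z)) := fun z =>
    isOpen_set_pi Set.finite_univ fun i _ => (hu z i).1
  obtain ⟨s, hs, hcover⟩ := TopologicalSpace.countable_cover_nhds
    (f := fun z => Set.univ.pi (u z)) fun z => (hopen z).mem_nhds fun i _ => (hu z i).2
  have hne : s.Nonempty := by
    obtain ⟨z⟩ := nonempty_of_isProbabilityMeasure ν
    have hz : z ∈ ⋃ w ∈ s, Set.univ.pi (u w) := hcover ▸ Set.mem_univ z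
    simp only [Set.mem_iUnion] at hz
    exact ⟨_, hz.choose_spec.choose⟩
  obtain ⟨e, rfl⟩ := hs.exists_eq_range hne
  have hmeas : ∀ k : ℕ, MeasurableSet (Set.univ.pi (u (e k))) := fun k =>
    MeasurableSet.univ_pi fun i => (hu (e k) i).1.measurableSet
  have hlim := tendsto_measure_iUnion_accumulate (μ := ν)
    (f := fun k : ℕ => Set.univ.pi (u (e k)))
  rw [← Set.biUnion_range (f := e) (g := fun z => Set.univ.pi (u z)), hcover,
    measure_univ] at hlim
  have hreal := (ENNReal.tendsto_toReal ENNReal.one_ne_top).comp hlim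
  obtain ⟨m, hm⟩ := (hreal.eventually (lt_mem_nhds (by simpa using hδ : 1 - δ < _))).exists
  have hGmeas : MeasurableSet (Set.accumulate (fun k : ℕ => Set.univ.pi (u (e k))) m) :=
    MeasurableSet.biUnion (Set.to_countable _) fun k _ => hmeas k
  refine ⟨m + 1, fun i x k => x ∈ u (e k) i, _, ?_, hGmeas, ?_, ?_⟩
  · exact fun i => measurable_pi_iff.2 fun k => (hu (e k) i).1.measurableSet.mem
  · rw [probReal_compl_eq_one_sub hGmeas]
    have : 1 - δ < ν.real _ := hm
    linarith
  · intro y hy x hxy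
    obtain ⟨k, hk, hyk⟩ := Set.mem_accumulate.1 hy
    have hxk : x ∈ Set.univ.pi (u (e k)) := fun i hi =>
      (congrFun (hxy i) ⟨k, Nat.lt_succ_of_le hk⟩).mpr (hyk i hi)
    have h₁ := hsub _ hxk
    have h₂ := hsub _ hyk
    rw [Set.mem_preimage, Metric.mem_ball, Real.dist_eq, abs_lt] at h₁ h₂
    linarith [h₁.2, h₂.1]

open Classical in
/-- Cyclical monotonicity compares a sample in `Γ` with an arbitrary sample, up to the mass outside
the good set, the discrepancy of label counts, and the tails of the bounding functions. -/
lemma CyclMono.sum_le_sum_add {d : ℕ} {X : Fin d → Type*} {c : (∀ i, X i) → ℝ}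
    {Γ : Set (∀ i, X i)} (h : CyclMono c Γ) (hc0 : ∀ x, 0 ≤ c x) {f : ∀ i, X i → ℝ}
    (hbound : ∀ x : ∀ i, X i, c x ≤ ∑ i, f i (x i)) {L : Type*} [Fintype L]
    {q : ∀ i, X i → L} {G : Set (∀ i, X i)} {ε M : ℝ} (hε : 0 ≤ ε) (hM : 0 ≤ M)
    (hG : ∀ y ∈ G, ∀ x, (∀ i, q i (x i) = q i (y i)) → c x ≤ c y + ε)
    {n : ℕ} {x : Fin n → ∀ i, X i} (hx : ∀ k, x k ∈ Γ) (y : Fin n → ∀ i, X i) :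
    ∑ k, c (x k) ≤ ∑ k, c (y k) + n * ε +
      d * M * (∑ k, (if y k ∈ G then (0 : ℝ) else 1) +
        ∑ i, ∑ l, |(∑ k, if q i (x k i) = l then (1 : ℝ) else 0) -
          ∑ k, if q i (y k i) = l then (1 : ℝ) else 0|) +
      ∑ i, ∑ k, max (f i (x k i) - M) 0 := by
  choose σ hσ using fun i => exists_perm_card_ne_le (fun k => q i (x k i)) fun k => q i (y k i)
  have hdM : 0 ≤ d * M := by positivity
  have hpoint : ∀ k, c (fun i => x (σ i k) i) ≤ c (y k) + ε +
      d * M * ((if y k ∈ G then (0 : ℝ) else 1) +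
        ∑ i, if q i (x (σ i k) i) = q i (y k i) then (0 : ℝ) else 1) +
      ∑ i, max (f i (x (σ i k) i) - M) 0 := by
    intro k
    have hmis : ∀ i, 0 ≤ if q i (x (σ i k) i) = q i (y k i) then (0 : ℝ) else 1 := fun i => by
      split_ifs <;> norm_num
    have hmis' : 0 ≤ if y k ∈ G then (0 : ℝ) else 1 := by split_ifs <;> norm_num
    have hsum := Finset.sum_nonneg fun i (_ : i ∈ Finset.univ) => hmis i
    have htail : 0 ≤ ∑ i, max (f i (x (σ i k) i) - M) 0 :=
      Finset.sum_nonneg fun i _ => le_max_right _ _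
    by_cases hgood : y k ∈ G ∧ ∀ i, q i (x (σ i k) i) = q i (y k i)
    · have h₁ := hG _ hgood.1 (fun i => x (σ i k) i) hgood.2
      have h₂ := mul_nonneg hdM (add_nonneg hmis' hsum)
      linarith
    · have hbad : 1 ≤ (if y k ∈ G then (0 : ℝ) else 1) +
          ∑ i, if q i (x (σ i k) i) = q i (y k i) then (0 : ℝ) else 1 := by
        by_cases hy : y k ∈ G
        · obtain ⟨i, hi⟩ := not_forall.1 (not_and.1 hgood hy)
          have := Finset.single_le_sum (fun i _ => hmis i) (Finset.mem_univ i)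
          rw [if_neg hi] at this
          linarith
        · rw [if_neg hy]
          linarith
      have h₁ : c (fun i => x (σ i k) i) ≤ d * M + ∑ i, max (f i (x (σ i k) i) - M) 0 := by
        refine (hbound _).trans ?_
        have : (d : ℝ) * M = ∑ _i : Fin d, M := by simp
        rw [this, ← Finset.sum_add_distrib]
        exact Finset.sum_le_sum fun i _ => by
          linarith [le_max_left (f i (x (σ i k) i) - M) 0]
      have h₂ := le_mul_of_one_le_right hdM hbad
      linarith [hc0 (y k)]
  have htails : ∑ k, ∑ i, max (f i (x (σ i k) i) - M) 0 =
      ∑ i, ∑ k, max (f i (x k i) - M) 0 := by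
    rw [Finset.sum_comm]
    exact Finset.sum_congr rfl fun i _ =>
      Equiv.sum_comp (σ i) fun k => max (f i (x k i) - M) 0
  have hsum := (h.sum_le hx σ).trans (Finset.sum_le_sum fun k _ => hpoint k)
  rw [Finset.sum_add_distrib, Finset.sum_add_distrib, Finset.sum_add_distrib, ← Finset.mul_sum,
    Finset.sum_add_distrib, htails, Finset.sum_comm (s := Finset.univ (α := Fin n))] at hsum
  refine hsum.trans ?_
  have hmatch := Finset.sum_le_sum fun i (_ : i ∈ Finset.univ) => hσ i
  simp only [Finset.sum_const, Finset.card_univ, Fintype.card_fin, nsmul_eq_mul]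
  gcongr

/-- The tails `(g - M)⁺` of an integrable function have vanishing integral. -/
lemma tendsto_integral_max_sub_zero {Ω : Type*} [MeasurableSpace Ω] {P : Measure Ω}
    {g : Ω → ℝ} (hg : Integrable g P) :
    Tendsto (fun M : ℕ => ∫ ω, max (g ω - M) 0 ∂P) atTop (𝓝 0) := by
  have h := tendsto_integral_of_dominated_convergence (μ := P)
    (F := fun (M : ℕ) ω => max (g ω - M) 0) (f := fun _ => 0) (fun ω => |g ω|)
    (fun M => ((hg.aestronglyMeasurable.sub aestronglyMeasurable_const).sup
      aestronglyMeasurable_const)) hg.abs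
    (fun M => ae_of_all _ fun ω => by
      rw [Real.norm_of_nonneg (le_max_right _ _)]
      exact max_le (by linarith [le_abs_self (g ω), (Nat.cast_nonneg M : (0 : ℝ) ≤ M)])
        (abs_nonneg _))
    (ae_of_all _ fun ω => by
      obtain ⟨N, hN⟩ := exists_nat_ge (g ω)
      refine tendsto_const_nhds.congr' ?_
      filter_upwards [eventually_ge_atTop N] with M hM
      have : (N : ℝ) ≤ M := Nat.cast_le.2 hM
      exact (max_eq_right (by linarith)).symm)
  simpa using h

lemma integrable_max_sub_zero {Ω : Type*} [MeasurableSpace Ω] {P : Measure Ω}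
    [IsFiniteMeasure P] {g : Ω → ℝ} (hg : Integrable g P) (M : ℝ) :
    Integrable (fun ω => max (g ω - M) 0) P :=
  (hg.sub (integrable_const M)).pos_part

open Classical in
/-- Averaging the finite-sample inequality along generic samples. -/
lemma CyclMono.integral_le_integral_add {d : ℕ} {X : Fin d → Type*} [∀ i, MeasurableSpace (X i)]
    {c : (∀ i, X i) → ℝ} {Γ : Set (∀ i, X i)} (h : CyclMono c Γ) (hc0 : ∀ x, 0 ≤ c x)
    {f : ∀ i, X i → ℝ} (hbound : ∀ x : ∀ i, X i, c x ≤ ∑ i, f i (x i))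
    {μ ν : Measure (∀ i, X i)} [IsProbabilityMeasure μ] [IsProbabilityMeasure ν]
    (hμν : ∀ i, μ.map (fun x => x i) = ν.map (fun x => x i)) (hΓ : μ Γᶜ = 0)
    (hcμ : Integrable c μ) (hcν : Integrable c ν) (hf : ∀ i, Integrable (fun x => f i (x i)) μ)
    {L : Type*} [Fintype L] [MeasurableSpace L] [MeasurableSingletonClass L]
    {q : ∀ i, X i → L} (hq : ∀ i, Measurable (q i)) {G : Set (∀ i, X i)} (hGm : MeasurableSet G)
    {ε M : ℝ} (hε : 0 ≤ ε) (hM : 0 ≤ M)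
    (hG : ∀ y ∈ G, ∀ x, (∀ i, q i (x i) = q i (y i)) → c x ≤ c y + ε) :
    ∫ x, c x ∂μ ≤ ∫ x, c x ∂ν + ε + d * M * ν.real Gᶜ +
      ∑ i, ∫ x, max (f i (x i) - M) 0 ∂μ := by
  have hlabel : ∀ i l, MeasurableSet {z : X i | q i z = l} := fun i l =>
    hq i (measurableSet_singleton l)
  have hlabel' : ∀ i l, MeasurableSet {x : ∀ i, X i | q i (x i) = l} := fun i l =>
    measurable_pi_apply i (hlabel i l)
  have hind : ∀ (P : Measure (∀ i, X i)) [IsProbabilityMeasure P] {s : Set (∀ i, X i)},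
      MeasurableSet s → Integrable (fun x => if x ∈ s then (1 : ℝ) else 0) P ∧
        ∫ x, (if x ∈ s then (1 : ℝ) else 0) ∂P = P.real s := by
    intro P _ s hs
    have hs' : (fun x => if x ∈ s then (1 : ℝ) else 0) = s.indicator 1 := by
      ext x
      simp [Set.indicator_apply]
    rw [hs']
    exact ⟨(integrable_const 1).indicator hs, integral_indicator_one hs⟩
  have hae : ∀ᵐ x ∂μ, x ∈ Γ := hΓ
  have hx := (ae_tendsto_average μ hcμ).and <|
    (ae_all_iff.2 fun k : ℕ =>
      (measurePreserving_eval_infinitePi (fun _ : ℕ => μ) k).quasiMeasurePreserving.ae hae).and <|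
    (ae_all_iff.2 fun i => ae_tendsto_average μ (integrable_max_sub_zero (hf i) M)).and <|
    ae_all_iff.2 fun i => ae_all_iff.2 fun l => ae_tendsto_average μ (hind μ (hlabel' i l)).1
  have hy := (ae_tendsto_average ν hcν).and <|
    (ae_tendsto_average ν (hind ν hGm.compl).1).and <|
    ae_all_iff.2 fun i => ae_all_iff.2 fun l => ae_tendsto_average ν (hind ν (hlabel' i l)).1
  obtain ⟨x, hxc, hxΓ, hxf, hxq⟩ := hx.exists
  obtain ⟨y, hyc, hyG, hyq⟩ := hy.exists
  have hdisc : ∀ i l, Tendsto (fun n : ℕ =>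
      |(∑ k : Fin n, if q i (x k i) = l then (1 : ℝ) else 0) / n -
        (∑ k : Fin n, if q i (y k i) = l then (1 : ℝ) else 0) / n|) atTop (𝓝 0) := by
    intro i l
    have hreal : μ.real {x : ∀ i, X i | q i (x i) = l} = ν.real {x : ∀ i, X i | q i (x i) = l} := by
      have := congrArg (fun P => P.real {z : X i | q i z = l}) (hμν i)
      simp only [map_measureReal_apply (measurable_pi_apply i) (hlabel i l)] at this
      exact this
    have hlim := ((hxq i l).sub (hyq i l)).abs
    rw [(hind μ (hlabel' i l)).2, (hind ν (hlabel' i l)).2, hreal, sub_self, abs_zero] at hlim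
    exact hlim
  rw [(hind ν hGm.compl).2] at hyG
  have hrhs := ((hyc.add_const ε).add ((hyG.add (tendsto_finsetSum Finset.univ fun i _ =>
    tendsto_finsetSum Finset.univ fun l _ => hdisc i l)).const_mul (d * M))).add
    (tendsto_finsetSum Finset.univ fun i _ => hxf i)
  simp only [Finset.sum_const_zero, add_zero] at hrhs
  refine le_of_tendsto_of_tendsto hxc hrhs ?_
  filter_upwards [eventually_gt_atTop 0] with n hn
  have hn' : (0 : ℝ) < n := Nat.cast_pos.2 hn
  have hfin := h.sum_le_sum_add hc0 hbound hε hM hG (x := fun k : Fin n => x k)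
    (fun k => hxΓ k) fun k => y k
  rw [div_le_iff₀ hn']
  refine hfin.trans_eq ?_
  simp only [← sub_div, abs_div, abs_of_pos hn', ← Finset.sum_div, Set.mem_compl_iff, ite_not]
  field_simp

/-- Main theorem: for a continuous nonnegative cost bounded by a sum of integrable
functions, every `c`-cyclically monotone coupling is optimal for the multi-marginal
Monge–Kantorovich problem. -/
theorem cyclMono_implies_optimal {d : ℕ} {X : Fin d → Type*}
    [∀ i, TopologicalSpace (X i)] [∀ i, PolishSpace (X i)]
    [∀ i, MeasurableSpace (X i)] [∀ i, BorelSpace (X i)]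
    (μi : ∀ i, Measure (X i)) [∀ i, IsProbabilityMeasure (μi i)]
    (c : (∀ i, X i) → ℝ) (hc : Continuous c) (hc0 : ∀ x, 0 ≤ c x)
    (f : ∀ i, X i → ℝ) (hfint : ∀ i, Integrable (f i) (μi i))
    (hbound : ∀ x : ∀ i, X i, c x ≤ ∑ i, f i (x i))
    (Γ : Set (∀ i, X i)) (hmono : CyclMono c Γ)
    (μ : Measure (∀ i, X i)) [IsProbabilityMeasure μ]
    (hmar : ∀ i, μ.map (fun x => x i) = μi i)
    (hconc : μ Γᶜ = 0) :
    ∀ μ' : Measure (∀ i, X i), IsProbabilityMeasure μ' →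
      (∀ i, μ'.map (fun x => x i) = μi i) →
      ∫⁻ x, ENNReal.ofReal (c x) ∂μ ≤ ∫⁻ x, ENNReal.ofReal (c x) ∂μ' := by
  intro μ' _ hmar'
  have hproj : ∀ (P : Measure (∀ i, X i)), (∀ i, P.map (fun x => x i) = μi i) →
      ∀ i, Integrable (fun x => f i (x i)) P := fun P hP i =>
    Integrable.comp_measurable (by rw [hP i]; exact hfint i) (measurable_pi_apply i)
  have hcint : ∀ (P : Measure (∀ i, X i)), (∀ i, P.map (fun x => x i) = μi i) →
      Integrable c P := fun P hP =>
    (integrable_finsetSum Finset.univ fun i _ => hproj P hP i).mono'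
      hc.measurable.aestronglyMeasurable
      (ae_of_all _ fun x => by simpa [abs_of_nonneg (hc0 x)] using hbound x)
  rw [← ofReal_integral_eq_lintegral_ofReal (hcint μ hmar) (ae_of_all _ hc0),
    ← ofReal_integral_eq_lintegral_ofReal (hcint μ' hmar') (ae_of_all _ hc0)]
  refine ENNReal.ofReal_le_ofReal (le_of_forall_pos_le_add fun ε hε => ?_)
  have htail := tendsto_finsetSum Finset.univ fun i _ =>
    tendsto_integral_max_sub_zero (hproj μ hmar i)
  rw [Finset.sum_const_zero] at htail
  obtain ⟨M, hM⟩ := (htail.eventually (gt_mem_nhds (by positivity : 0 < ε / 3))).exists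
  have hdM : (0 : ℝ) < d * M + 1 := by positivity
  obtain ⟨m, q, G, hq, hGm, hGδ, hG⟩ := exists_labels hc μ' (by positivity : 0 < ε / 3)
    (by positivity : 0 < ε / 3 / (d * M + 1))
  classical
  have hle := hmono.integral_le_integral_add hc0 hbound
    (fun i => (hmar i).trans (hmar' i).symm) hconc (hcint μ hmar) (hcint μ' hmar')
    (hproj μ hmar) hq hGm (by positivity) M.cast_nonneg hG
  have hsmall : d * M * μ'.real Gᶜ ≤ ε / 3 := by
    rw [lt_div_iff₀ hdM] at hGδ
    nlinarith [measureReal_nonneg (μ := μ') (s := Gᶜ)]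
  linarith
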